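/- Let C = P + εQ ∈ 𝔻ℍ[t] be a monic motion polynomial of degree n whose primal part P ∈ ℍ[t] is divisible by no nonconstant real polynomial. Then the set of ordered n-tuples (h₁, …, hₙ) of dual quaternions such that C = (t − h₁)(t − h₂)⋯(t − hₙ) and each factor t − hᵢ is a motion polynomial is finite and has at most n! elements. -/

import Mathlib

noncomputable section
open Polynomial

/-- The real quaternions ℍ. -/
abbrev Quat := Quaternion ℝ

/-- The dual quaternions 𝔻ℍ = ℍ ⊕ εℍ, realized as dual numbers over ℍ.
An element is a pair `(p, q)` representing `p + εq`. -/
abbrev DQ := DualNumber Quat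

/-- Conjugation of a dual quaternion `p + εq ↦ p̄ + εq̄`,
conjugating each quaternion part. -/
def dconj (h : DQ) : DQ := (star h.fst, star h.snd)

/-- The canonical ring homomorphism ℝ → 𝔻ℍ. -/
def realToDQ : ℝ →+* DQ := (TrivSqZeroExt.inlHom Quat Quat).comp (algebraMap ℝ Quat)

/-- Coefficientwise conjugate of a polynomial over 𝔻ℍ. -/
def pconj (C : DQ[X]) : DQ[X] := C.sum fun n a => Polynomial.C (dconj a) * X ^ n

/-- `C ∈ 𝔻ℍ[t]` is a motion polynomial if `C C̄ ∈ ℝ[t] \ {0}` and the leading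
coefficient of `C` is invertible. -/
def IsMotionPoly (C : DQ[X]) : Prop :=
  (∃ R : ℝ[X], R ≠ 0 ∧ C * pconj C = R.map realToDQ) ∧ IsUnit C.leadingCoeff

/-- The action of a dual quaternion `p + εq` (with `p ≠ 0` and satisfying the Study
condition) on a pure quaternion `x`:  `x ↦ (p x p̄ + p q̄ − q p̄)/N(p)`. -/
def act (p q x : Quat) : Quat :=
  (p * x * star p + p * star q - q * star p) * (p * star p)⁻¹

/-- The dual quaternion `p + εq` from its primal part `p` and dual part `q`. -/
def dq (p q : Quat) : DQ := (p, q)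

/-- The primal part of a polynomial over 𝔻ℍ: take the primal part of each
coefficient, giving a polynomial over ℍ. -/
def primal (C : DQ[X]) : Quat[X] :=
  C.map (TrivSqZeroExt.fstHom ℝ Quat Quat).toRingHom

/-- `P ∈ ℍ[t]` is divisible by no nonconstant real polynomial. -/
def NoRealFactor (P : Quat[X]) : Prop :=
  ∀ R : ℝ[X], 0 < R.natDegree → ¬ R.map (algebraMap ℝ Quat) ∣ P

/-- The real quadratic norm polynomial of `X - p`. -/
def Mp (p : Quat) : ℝ[X] := X ^ 2 - C (2 * p.re) * X + C (p.re * p.re + p.imI * p.imI + p.imJ * p.imJ + p.imK * p.imK)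

lemma Mp_eq (p : Quat) : Mp p = X ^ 2 + (C (-(2 * p.re)) * X +
    C (p.re * p.re + p.imI * p.imI + p.imJ * p.imJ + p.imK * p.imK)) := by
  simp only [Mp, map_neg]; ring

lemma Mp_natDegree (p : Quat) : (Mp p).natDegree = 2 := by
  rw [Mp_eq]; compute_degree!

lemma Mp_monic (p : Quat) : (Mp p).Monic := by
  rw [Mp_eq]; monicity!

lemma Mp_irr (p : Quat) (hp : 0 < p.imI ^ 2 + p.imJ ^ 2 + p.imK ^ 2) : Irreducible (Mp p) := by
  rw [(Mp_monic p).irreducible_iff_roots_eq_zero_of_degree_le_three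
    (by rw [Mp_natDegree]) (by rw [Mp_natDegree]; norm_num)]
  rw [Multiset.eq_zero_iff_forall_notMem]
  intro x hx
  rw [mem_roots (Mp_monic p).ne_zero, IsRoot.def] at hx
  simp [Mp] at hx
  nlinarith [sq_nonneg (x - p.re)]

/-- Real polynomials are central. -/
lemma comm_real {A : Type*} [Ring A] (f : ℝ →+* A) (hf : ∀ r a, Commute (f r) a) (R : ℝ[X]) (S : A[X]) :
    R.map f * S = S * R.map f := by
  induction R using Polynomial.induction_on' with
  | add p q hp hq => simp [add_mul, mul_add, hp, hq]
  | monomial n a =>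
    rw [map_monomial, ← C_mul_X_pow_eq_monomial]
    have h1 : C (f a) * S = S * C (f a) := by
      ext n; simp [(hf a _).eq]
    rw [mul_assoc, X_pow_mul, ← mul_assoc, h1, mul_assoc]

lemma commQ (R : ℝ[X]) (S : Quat[X]) :
    R.map (algebraMap ℝ Quat) * S = S * R.map (algebraMap ℝ Quat) :=
  comm_real _ (fun r a => Algebra.commutes r a) R S

lemma realToDQ_comm (r : ℝ) (a : DQ) : Commute (realToDQ r) a := by
  change _ = _
  apply TrivSqZeroExt.ext
  · simpa [realToDQ] using Algebra.commutes r a.fst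
  · simpa [realToDQ] using Algebra.commutes r a.snd

lemma commD (R : ℝ[X]) (S : DQ[X]) :
    R.map realToDQ * S = S * R.map realToDQ :=
  comm_real _ realToDQ_comm R S

lemma quad_expand {A : Type*} [Ring A] (a b : A) :
    (X - C a) * (X - C b) = X ^ 2 - C (a + b) * X + C (a * b) := by
  simp only [C_add, C_mul, sub_mul, mul_sub, add_mul, X_mul_C, sq]; abel

lemma Mp_mapQ (p : Quat) :
    (Mp p).map (algebraMap ℝ Quat) = (X - C (star p)) * (X - C p) := by
  rw [quad_expand]
  simp only [Mp, Polynomial.map_add, Polynomial.map_sub, Polynomial.map_mul, Polynomial.map_pow,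
    map_X, map_C]
  congr 3
  · congr 1
    ext <;> simp [two_mul]
  · ext <;> simp <;> ring

lemma Mp_mapQ' (p : Quat) :
    (Mp p).map (algebraMap ℝ Quat) = (X - C p) * (X - C (star p)) := by
  rw [quad_expand]
  simp only [Mp, Polynomial.map_add, Polynomial.map_sub, Polynomial.map_mul, Polynomial.map_pow,
    map_X, map_C]
  congr 3
  · congr 1
    ext <;> simp [two_mul]
  · ext <;> simp <;> ring

lemma dconj_fst (h : DQ) : (dconj h).fst = star h.fst := rfl
lemma dconj_snd (h : DQ) : (dconj h).snd = star h.snd := rfl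

lemma coeff_pconj (D : DQ[X]) (n : ℕ) : (pconj D).coeff n = dconj (D.coeff n) := by
  have h0 : dconj 0 = 0 := by
    apply TrivSqZeroExt.ext <;> simp [dconj_fst, dconj_snd]
  rw [pconj, Polynomial.sum_def, finsetSum_coeff]
  simp only [coeff_C_mul, coeff_X_pow]
  simp +contextual [h0]

lemma pconj_lin (h : DQ) : pconj (X - C h) = X - C (dconj h) := by
  ext1 n
  rw [coeff_pconj]
  rcases n with _ | _ | n
  · simp; apply TrivSqZeroExt.ext <;> simp [dconj_fst, dconj_snd]
  · simp [coeff_X, coeff_C]; apply TrivSqZeroExt.ext <;> simp [dconj_fst, dconj_snd]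
  · simp [coeff_X, coeff_C]; apply TrivSqZeroExt.ext <;> simp [dconj_fst, dconj_snd]

lemma motion_map (h : DQ) (hm : IsMotionPoly (X - C h)) :
    (Mp h.fst).map realToDQ = (X - C (dconj h)) * (X - C h) := by
  obtain ⟨⟨R, -, hR⟩, -⟩ := hm
  rw [pconj_lin, quad_expand] at hR
  have h1 := congrArg (fun q => coeff q 1) hR
  have h0 := congrArg (fun q => coeff q 0) hR
  simp [coeff_X, coeff_C, coeff_one] at h1 h0
  have k1 := congrArg TrivSqZeroExt.snd h1
  have k0 := congrArg TrivSqZeroExt.snd h0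
  simp [realToDQ, dconj_fst, dconj_snd] at k1 k0
  have k2 : star h.snd = - h.snd := by
    rw [← sub_eq_zero, sub_neg_eq_add, ← neg_eq_zero, neg_add]
    first | exact k1 | (rw [← k1]; abel)
  rw [k2] at k0
  rw [quad_expand]
  simp only [Mp, Polynomial.map_add, Polynomial.map_sub, Polynomial.map_mul, Polynomial.map_pow,
    map_X, map_C]
  have e1 : realToDQ (2 * h.fst.re) = dconj h + h := by
    apply TrivSqZeroExt.ext
    · simp [realToDQ, dconj_fst]
      ext <;> simp [two_mul]
    · simp [realToDQ, dconj_snd, k2]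
  have e2 : realToDQ (h.fst.re * h.fst.re + h.fst.imI * h.fst.imI + h.fst.imJ * h.fst.imJ + h.fst.imK * h.fst.imK) = dconj h * h := by
    apply TrivSqZeroExt.ext
    · simp only [realToDQ, dconj_fst, TrivSqZeroExt.fst_mul, RingHom.comp_apply, TrivSqZeroExt.inlHom_apply, TrivSqZeroExt.fst_inl]
      ext <;> simp <;> ring
    · simp [realToDQ, dconj_fst, dconj_snd, k2]
      have hre := congrArg QuaternionAlgebra.re k2
      simp at hre
      have hre : h.snd.re = 0 := by linarith
      have key : star h.fst * h.snd + -(h.snd * h.fst) = h.fst * -h.snd + h.snd * star h.fst := by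
        ext <;> simp [hre] <;> ring
      rw [key, k0]
  rw [e1, e2]

/-- The primal map as a ring hom. -/
lemma primal_mul (A B : DQ[X]) : primal (A * B) = primal A * primal B := by
  simp [primal]

lemma primal_lin (h : DQ) : primal (X - C h) = X - C h.fst := by
  simp [primal]

lemma primal_real (R : ℝ[X]) : primal (R.map realToDQ) = R.map (algebraMap ℝ Quat) := by
  rw [primal, map_map]; rfl

lemma primal_prod (l : List DQ) : primal (l.map fun h => X - C h).prod =
    ((l.map TrivSqZeroExt.fst).map fun p => X - C p).prod := by
  induction l with
  | nil => simp [primal]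
  | cons a l ih => simp only [List.map_cons, List.prod_cons, primal_mul, primal_lin, ih]

lemma dvd_step (M N : ℝ[X]) (h : IsCoprime M N) (S : Quat[X])
    (hd : M.map (algebraMap ℝ Quat) ∣ N.map (algebraMap ℝ Quat) * S) :
    M.map (algebraMap ℝ Quat) ∣ S := by
  obtain ⟨u, v, huv⟩ := h
  have h1 : S = M.map (algebraMap ℝ Quat) * (u.map (algebraMap ℝ Quat) * S) +
      v.map (algebraMap ℝ Quat) * (N.map (algebraMap ℝ Quat) * S) := by
    have := congrArg (fun q => q.map (algebraMap ℝ Quat) * S) huv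
    simp only [Polynomial.map_add, Polynomial.map_mul, Polynomial.map_one, one_mul, add_mul] at this
    rw [← mul_assoc, ← mul_assoc, commQ M, this]
  rw [h1]
  obtain ⟨T, hT⟩ := hd
  refine dvd_add (dvd_mul_right _ _) ⟨v.map (algebraMap ℝ Quat) * T, ?_⟩
  rw [hT, ← mul_assoc, ← mul_assoc, commQ M]

lemma dvd_list (M : ℝ[X]) (l : List Quat) (hl : ∀ p ∈ l, IsCoprime M (Mp p)) (S : Quat[X])
    (hd : M.map (algebraMap ℝ Quat) ∣ (l.map fun p => X - C p).prod * S) :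
    M.map (algebraMap ℝ Quat) ∣ S := by
  induction l with
  | nil => simpa using hd
  | cons a l ih =>
    apply ih (fun p hp => hl p (List.mem_cons_of_mem _ hp))
    apply dvd_step M (Mp a) (hl a List.mem_cons_self)
    obtain ⟨T, hT⟩ := hd
    refine ⟨(X - C (star a)) * T, ?_⟩
    rw [Mp_mapQ, ← mul_assoc, mul_assoc _ _ S, commQ M, mul_assoc _ T, ← commQ M, ← hT]
    simp [mul_assoc]

/-- Norm polynomial of a right factor occurs among the norm polynomials of any factorization. -/
lemma exists_Mp (P P' : Quat[X]) (hP : NoRealFactor P) (l : List Quat)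
    (hl : P = (l.map fun p => X - C p).prod) (p : Quat) (hp : P = P' * (X - C p)) :
    ∃ a ∈ l, Mp a = Mp p := by
  have him : 0 < p.imI ^ 2 + p.imJ ^ 2 + p.imK ^ 2 := by
    by_contra hc
    have h1 : p.imI = 0 := by nlinarith [sq_nonneg p.imI, sq_nonneg p.imJ, sq_nonneg p.imK]
    have h2 : p.imJ = 0 := by nlinarith [sq_nonneg p.imI, sq_nonneg p.imJ, sq_nonneg p.imK]
    have h3 : p.imK = 0 := by nlinarith [sq_nonneg p.imI, sq_nonneg p.imJ, sq_nonneg p.imK]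
    have h4 : p = algebraMap ℝ Quat p.re := by ext <;> simp [h1, h2, h3]
    apply hP (X - C p.re) (by simp)
    refine ⟨P', ?_⟩
    rw [commQ, hp]
    simp [← h4]
  have hirr := Mp_irr p him
  by_contra hc
  push Not at hc
  have hd : (Mp p).map (algebraMap ℝ Quat) ∣ (X - C (star p)) := by
    apply dvd_list (Mp p) l
    · intro a ha
      rw [hirr.coprime_iff_not_dvd]
      intro hdvd
      exact hc a ha (eq_of_monic_of_dvd_of_natDegree_le (Mp_monic p) (Mp_monic a) hdvd
        (by rw [Mp_natDegree, Mp_natDegree]))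
    · rw [← hl, hp, mul_assoc, ← Mp_mapQ', ← commQ]
      exact dvd_mul_right _ _
  have := natDegree_le_of_dvd hd (X_sub_C_ne_zero _)
  rw [natDegree_map, Mp_natDegree] at this
  simp at this

lemma unique_right (D A B : DQ[X]) (hP : NoRealFactor (primal D)) (h k : DQ)
    (hh : IsMotionPoly (X - C h)) (hk : IsMotionPoly (X - C k))
    (hA : D = A * (X - C h)) (hB : D = B * (X - C k)) (hM : Mp h.fst = Mp k.fst) : h = k := by
  set M := (Mp h.fst).map realToDQ with hMd
  have hMm : M.Monic := (Mp_monic _).map _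
  have hdeg : M.natDegree = 2 := by rw [hMd, (Mp_monic _).natDegree_map, Mp_natDegree]
  have e1 := motion_map h hh
  have e2 := motion_map k hk
  rw [← hM] at e2
  set r := D %ₘ M with hr
  have hrdeg : r.natDegree < 2 := by
    rw [← hdeg]
    exact natDegree_modByMonic_lt D hMm (by intro h1; rw [h1] at hdeg; simp at hdeg)
  have hD : r + M * (D /ₘ M) = D := modByMonic_add_div D M
  have hform : r = C (r.coeff 1) * X + C (r.coeff 0) := 
    eq_X_add_C_of_natDegree_le_one (by omega)
  have ev : ∀ (x : DQ) (E F : DQ[X]), D = E * (X - C x) → M = F * (X - C x) →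
      r.coeff 1 * x + r.coeff 0 = 0 := by
    intro x E F hE hF
    have : r = (E - (D /ₘ M) * F) * (X - C x) := by
      rw [sub_mul, ← hE, mul_assoc, ← hF, ← commD, ← hMd]
      exact eq_sub_of_add_eq hD
    have h2 := congrArg (eval x) this
    rw [eval_mul_X_sub_C, hform] at h2
    simpa using h2
  have v1 := ev h A _ hA e1
  have v2 := ev k B _ hB e2
  have hne : (r.coeff 1).fst ≠ 0 := by
    intro h1
    have h0 : (r.coeff 0).fst = 0 := by
      have := congrArg TrivSqZeroExt.fst v1
      simpa [h1] using this
    apply hP (Mp h.fst) (by rw [Mp_natDegree]; norm_num)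
    refine ⟨primal (D /ₘ M), ?_⟩
    have hr0 : primal r = 0 := by
      rw [hform]; simp [primal, h1, h0]
    calc primal D = primal (r + M * (D /ₘ M)) := by rw [hD]
      _ = primal r + primal (M * (D /ₘ M)) := by simp [primal]
      _ = _ := by rw [hr0, zero_add, primal_mul, hMd, primal_real]
  have hu : IsUnit (r.coeff 1) := by
    rw [TrivSqZeroExt.isUnit_iff_isUnit_fst]; exact hne.isUnit
  have : r.coeff 1 * h = r.coeff 1 * k := by
    rw [eq_neg_of_add_eq_zero_left v1, eq_neg_of_add_eq_zero_left v2]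
  exact hu.mul_left_cancel this

lemma main_bound (n : ℕ) : ∀ (D : DQ[X]), NoRealFactor (primal D) →
    ∃ F : Finset (Fin n → DQ), F.card ≤ n.factorial ∧ ∀ h : Fin n → DQ,
      D = (List.ofFn fun i => X - Polynomial.C (h i)).prod →
      (∀ i, IsMotionPoly (X - Polynomial.C (h i))) → h ∈ F := by
  classical
  induction n with
  | zero =>
    intro D _
    exact ⟨Finset.univ, by simp, fun h _ _ => Finset.mem_univ h⟩
  | succ n ih =>
    intro D hD
    by_cases hex : ∃ h : Fin (n+1) → DQ, D = (List.ofFn fun i => X - Polynomial.C (h i)).prod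
    swap
    · push Not at hex
      exact ⟨∅, by simp, fun h hh => absurd hh (hex h)⟩
    obtain ⟨h0, hh0⟩ := hex
    let good : DQ → Prop := fun x => IsMotionPoly (X - C x) ∧ ∃ A, D = A * (X - C x)
    have hgood : ∀ x, good x → ∃ i, Mp (h0 i).fst = Mp x.fst := by
      rintro x ⟨-, A, hA⟩
      have hl : primal D = (((List.ofFn h0).map TrivSqZeroExt.fst).map fun p => X - C p).prod := by
        rw [← primal_prod, hh0, List.map_ofFn]; rfl
      obtain ⟨a, ha, hM⟩ := exists_Mp (primal D) (primal A) hD _ hl x.fst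
        (by rw [hA, primal_mul, primal_lin])
      simp only [List.map_ofFn, List.mem_ofFn, Set.mem_range] at ha
      obtain ⟨i, rfl⟩ := ha
      exact ⟨i, hM⟩
    let g : Fin (n+1) → DQ := fun i =>
      if hi : ∃ x, good x ∧ Mp (h0 i).fst = Mp x.fst then hi.choose else 0
    have hg : ∀ x, good x → ∃ i, g i = x := by
      intro x hx
      obtain ⟨i, hi⟩ := hgood x hx
      refine ⟨i, ?_⟩
      have hi' : ∃ x, good x ∧ Mp (h0 i).fst = Mp x.fst := ⟨x, hx, hi⟩
      have hc := hi'.choose_spec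
      have : g i = hi'.choose := dif_pos hi'
      rw [this]
      obtain ⟨A, hA⟩ := hx.2
      obtain ⟨B, hB⟩ := hc.1.2
      exact unique_right D B A hD _ _ hc.1.1 hx.1 hB hA (hc.2.symm.trans hi)
    have hF : ∀ x : DQ, ∃ F : Finset (Fin n → DQ), F.card ≤ n.factorial ∧ ∀ A : DQ[X],
        D = A * (X - C x) → ∀ h : Fin n → DQ,
        A = (List.ofFn fun i => X - Polynomial.C (h i)).prod →
        (∀ i, IsMotionPoly (X - Polynomial.C (h i))) → h ∈ F := by
      intro x
      by_cases hx : ∃ A, D = A * (X - C x)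
      swap
      · push Not at hx
        exact ⟨∅, by simp, fun A hA => absurd hA (hx A)⟩
      obtain ⟨A, hA⟩ := hx
      have hPA : NoRealFactor (primal A) := by
        intro R hR hdvd
        apply hD R hR
        rw [hA, primal_mul]
        exact hdvd.mul_right _
      obtain ⟨F, hFc, hFm⟩ := ih A hPA
      refine ⟨F, hFc, ?_⟩
      intro B hB h hBh hm
      refine hFm h ?_ hm
      rw [← hBh]
      exact (monic_X_sub_C x).isRegular.right (hA.symm.trans hB)
    choose F hFc hFm using hF
    refine ⟨(Finset.univ : Finset (Fin (n+1))).biUnion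
      (fun i => (F (g i)).image (fun h => (Fin.snoc h (g i) : Fin (n+1) → DQ))), ?_, ?_⟩
    · refine (Finset.card_biUnion_le_card_mul _ _ n.factorial
        (fun i _ => Finset.card_image_le.trans (hFc _))).trans ?_
      simp [Nat.factorial_succ]
    · intro h hh hm
      have hsplit : D = (List.ofFn fun i : Fin n => X - Polynomial.C (h i.castSucc)).prod *
          (X - C (h (Fin.last n))) := by
        rw [hh, List.ofFn_succ', List.concat_eq_append, List.prod_append, List.prod_singleton]
      obtain ⟨i, hi⟩ := hg (h (Fin.last n)) ⟨hm _, _, hsplit⟩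
      rw [Finset.mem_biUnion]
      refine ⟨i, Finset.mem_univ _, ?_⟩
      rw [Finset.mem_image, hi]
      refine ⟨fun i => h i.castSucc, hFm _ _ hsplit _ rfl (fun i => hm _), ?_⟩
      exact Fin.snoc_init_self h

open Nat in
/-- For a monic motion polynomial of degree n whose primal part has
no nonconstant real factor, the set of ordered n-tuples (h₁, …, hₙ) with
`C = (t − h₁)⋯(t − hₙ)` and each `t − hᵢ` a motion polynomial is finite with at
most n! elements. -/
theorem stmt12 (n : ℕ) (C : DQ[X]) (hmonic : C.Monic) (hdeg : C.natDegree = n)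
    (hmp : IsMotionPoly C) (hprim : NoRealFactor (primal C)) :
    {h : Fin n → DQ |
        C = (List.ofFn fun i => X - Polynomial.C (h i)).prod ∧
        ∀ i, IsMotionPoly (X - Polynomial.C (h i))}.Finite ∧
    {h : Fin n → DQ |
        C = (List.ofFn fun i => X - Polynomial.C (h i)).prod ∧
        ∀ i, IsMotionPoly (X - Polynomial.C (h i))}.ncard ≤ n ! := by
  obtain ⟨F, hFc, hFm⟩ := main_bound n C hprim
  have hsub : {h : Fin n → DQ |
        C = (List.ofFn fun i => X - Polynomial.C (h i)).prod ∧
        ∀ i, IsMotionPoly (X - Polynomial.C (h i))} ⊆ (F : Set (Fin n → DQ)) :=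
    fun h hh => hFm h hh.1 hh.2
  refine ⟨F.finite_toSet.subset hsub, ?_⟩
  refine (Set.ncard_le_ncard hsub F.finite_toSet).trans ?_
  rw [Set.ncard_coe_finset]
  exact hFc
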